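/- Let n, f, b, r be natural numbers with r ≤ b, let A_1, …, A_n ∈ ℝ^{f×b}, let Z ∈ ℝ^{n×n}, and let λ ∈ ℝ. Define J(P) = Σ_{i=1}^n ( ‖A_i P − Σ_{j=1}^n A_j P Z_{ji}‖_F² + λ ‖A_i − A_i P Pᵀ‖_F² ) for P ∈ ℝ^{b×r}. Set K_{ij} = A_iᵀ A_j, H₁ = Σ_i K_{ii}, H₂ = Σ_{s,t} (Σ_i Z_{si} Z_{ti}) · K_{st}, H₃ = Σ_{i,j} Z_{ji} · (K_{ij} + K_{ji}), and M = (1 − λ) H₁ + H₂ − H₃. Then the minimum of J over the set { P ∈ ℝ^{b×r} : Pᵀ P = I_r } is attained, and its value equals (λ₁ + ⋯ + λ_r) + λ · Σ_{i=1}^n Tr(K_{ii}), where λ₁ ≤ ⋯ ≤ λ_b are the eigenvalues of the symmetric matrix M listed in nondecreasing order with multiplicity. -/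

import Mathlib

open Matrix

/-- Squared Frobenius norm of a real matrix. -/
noncomputable def frobSq {α β : Type*} [Fintype α] [Fintype β]
    (M : Matrix α β ℝ) : ℝ := ∑ i, ∑ j, (M i j) ^ 2

theorem frobSq_eq_trace {α β : Type*} [Fintype α] [Fintype β] (B : Matrix α β ℝ) :
    frobSq B = (Bᵀ * B).trace := by
  rw [frobSq, Finset.sum_comm]
  simp [Matrix.trace, Matrix.mul_apply, pow_two]

theorem frobSq_sub_mul_mul_transpose {α β γ : Type*} [Fintype α] [Fintype β] [Fintype γ]
    [DecidableEq γ] (B : Matrix α β ℝ) (P : Matrix β γ ℝ) (hP : Pᵀ * P = 1) :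
    frobSq (B - B * P * Pᵀ) = (Bᵀ * B).trace - (Pᵀ * (Bᵀ * B) * P).trace := by
  have h1 : ((B * P * Pᵀ)ᵀ * B).trace = (Pᵀ * (Bᵀ * B) * P).trace := by
    simp only [transpose_mul, transpose_transpose, Matrix.mul_assoc]
    rw [Matrix.trace_mul_comm P]
    simp only [Matrix.mul_assoc]
  have h2 : (Bᵀ * (B * P * Pᵀ)).trace = (Pᵀ * (Bᵀ * B) * P).trace := by
    rw [← Matrix.mul_assoc, Matrix.trace_mul_comm]
    simp only [Matrix.mul_assoc]
  have h3 : ((B * P * Pᵀ)ᵀ * (B * P * Pᵀ)).trace = (Pᵀ * (Bᵀ * B) * P).trace := by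
    simp only [transpose_mul, transpose_transpose, Matrix.mul_assoc]
    rw [Matrix.trace_mul_comm P]
    simp only [Matrix.mul_assoc, hP, Matrix.mul_one]
  rw [frobSq_eq_trace, transpose_sub, Matrix.sub_mul, Matrix.mul_sub, Matrix.mul_sub,
    trace_sub, trace_sub, trace_sub, h1, h2, h3]
  ring

theorem frobSq_sub_sum_smul {ι α β γ : Type*} [Fintype ι] [Fintype α] [Fintype β] [Fintype γ]
    (A : ι → Matrix α β ℝ) (z : ι → ℝ) (i : ι) (P : Matrix β γ ℝ) :
    frobSq (A i * P - ∑ j, z j • (A j * P)) =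
      (Pᵀ * ((A i)ᵀ * A i + ∑ s, ∑ t, (z s * z t) • ((A s)ᵀ * A t)
        - ∑ j, z j • ((A i)ᵀ * A j + (A j)ᵀ * A i)) * P).trace := by
  rw [frobSq_eq_trace]
  have h : A i * P - ∑ j, z j • (A j * P) = (A i - ∑ j, z j • A j) * P := by
    simp only [Matrix.sub_mul, Matrix.sum_mul, Matrix.smul_mul]
  rw [h, transpose_mul, ← Matrix.mul_assoc, Matrix.mul_assoc Pᵀ]
  congr 3
  simp only [transpose_sub, transpose_sum, transpose_smul, Matrix.sub_mul, Matrix.mul_sub,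
    Matrix.sum_mul, Matrix.mul_sum, Matrix.smul_mul, Matrix.mul_smul, smul_add,
    smul_sub,
    Finset.sum_add_distrib, Finset.sum_sub_distrib, Finset.smul_sum, smul_smul]
  rw [Finset.sum_comm (f := fun s t => (z s * z t) • ((A s)ᵀ * A t))]
  simp only [mul_comm]
  abel

/-- A weighted sum of nondecreasing reals, with weights in `[0, 1]` of total mass `r`, is at least
the sum of the first `r` of them. -/
theorem sum_castLE_le_sum_mul {b r : ℕ} (hr : r ≤ b) (μ : Fin b → ℝ) (hμ : Monotone μ)
    (w : Fin b → ℝ) (h0 : ∀ i, 0 ≤ w i) (h1 : ∀ i, w i ≤ 1) (hw : ∑ i, w i = r) :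
    ∑ k : Fin r, μ (Fin.castLE hr k) ≤ ∑ i, μ i * w i := by
  obtain ⟨c, rfl⟩ := Nat.exists_eq_add_of_le hr
  obtain ⟨m, hlo, hhi⟩ : ∃ m, (∀ k : Fin r, μ (Fin.castAdd c k) ≤ m) ∧
      ∀ k : Fin c, m ≤ μ (Fin.natAdd r k) := by
    rcases r with _ | r
    · rcases c with _ | c
      · exact ⟨0, fun k => k.elim0, fun k => k.elim0⟩
      · exact ⟨μ (Fin.natAdd 0 0), fun k => k.elim0, fun k => hμ (by simp)⟩
    · refine ⟨μ (Fin.castAdd c (Fin.last r)), fun k => hμ ?_, fun k => hμ ?_⟩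
      · simpa [Fin.le_def] using Nat.le_of_lt_succ k.2
      · simp only [Fin.le_def, Fin.val_castAdd, Fin.val_natAdd, Fin.val_last]
        omega
  have hm : ∑ i, μ i * w i = ∑ i, (μ i - m) * w i + m * r := by
    rw [← hw, Finset.mul_sum, ← Finset.sum_add_distrib]
    exact Finset.sum_congr rfl fun i _ => by ring
  have hL : ∑ k : Fin r, μ (Fin.castLE hr k)
      = ∑ k : Fin r, (μ (Fin.castAdd c k) - m) + m * r := by
    simp only [Finset.sum_sub_distrib, Finset.sum_const, Finset.card_univ, Fintype.card_fin,
      nsmul_eq_mul]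
    rw [mul_comm m, sub_add_cancel]
    rfl
  rw [hm, hL, Fin.sum_univ_add]
  have hA : ∑ k : Fin r, (μ (Fin.castAdd c k) - m)
      ≤ ∑ k : Fin r, (μ (Fin.castAdd c k) - m) * w (Fin.castAdd c k) :=
    Finset.sum_le_sum fun k _ => by nlinarith [hlo k, h1 (Fin.castAdd c k)]
  have hB : 0 ≤ ∑ k : Fin c, (μ (Fin.natAdd r k) - m) * w (Fin.natAdd r k) :=
    Finset.sum_nonneg fun k _ => mul_nonneg (sub_nonneg.2 (hhi k)) (h0 _)
  linarith

theorem mul_transpose_apply_self_le_one {β γ : Type*} [Fintype β] [Fintype γ] [DecidableEq γ]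
    (Q : Matrix β γ ℝ) (hQ : Qᵀ * Q = 1) (i : β) : (Q * Qᵀ) i i ≤ 1 := by
  have hidem : (Q * Qᵀ) * (Q * Qᵀ)ᵀ = Q * Qᵀ := by
    rw [transpose_mul, transpose_transpose, Matrix.mul_assoc, ← Matrix.mul_assoc Qᵀ, hQ,
      Matrix.one_mul]
  have h : (Q * Qᵀ) i i ^ 2 ≤ (Q * Qᵀ) i i := by
    conv_rhs => rw [← hidem, Matrix.mul_apply]
    simp only [transpose_apply (Q * Qᵀ), ← pow_two]
    exact Finset.single_le_sum (f := fun j => (Q * Qᵀ) i j ^ 2) (fun j _ => sq_nonneg _)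
      (Finset.mem_univ i)
  nlinarith

theorem sum_castLE_le_trace_of_diagonal {b r : ℕ} (hr : r ≤ b) (μ : Fin b → ℝ) (hμ : Monotone μ)
    (Q : Matrix (Fin b) (Fin r) ℝ) (hQ : Qᵀ * Q = 1) :
    ∑ k : Fin r, μ (Fin.castLE hr k) ≤ (Qᵀ * diagonal μ * Q).trace := by
  have h : (Qᵀ * diagonal μ * Q).trace = ∑ i, μ i * (Q * Qᵀ) i i := by
    rw [Matrix.mul_assoc, Matrix.trace_mul_comm, Matrix.mul_assoc]
    simp [Matrix.trace, Matrix.diagonal_mul]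
  rw [h]
  refine sum_castLE_le_sum_mul hr μ hμ _ (fun i => ?_)
    (mul_transpose_apply_self_le_one Q hQ) ?_
  · simp only [Matrix.mul_apply, transpose_apply]
    exact Finset.sum_nonneg fun k _ => mul_self_nonneg _
  · change (Q * Qᵀ).trace = r
    rw [Matrix.trace_mul_comm, hQ]
    simp

/-- **Ky Fan's minimum principle** for a real symmetric matrix with a given spectral
decomposition. -/
theorem isLeast_trace_compression {b r : ℕ} (hr : r ≤ b) (μ : Fin b → ℝ) (hμ : Monotone μ)
    (U : Matrix (Fin b) (Fin b) ℝ) (hU : Uᵀ * U = 1) :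
    IsLeast {x : ℝ | ∃ P : Matrix (Fin b) (Fin r) ℝ, Pᵀ * P = 1 ∧
        x = (Pᵀ * (U * diagonal μ * Uᵀ) * P).trace}
      (∑ k : Fin r, μ (Fin.castLE hr k)) := by
  have hinj : Function.Injective (Fin.castLE hr) := Fin.castLE_injective hr
  have hU' : U * Uᵀ = 1 := mul_eq_one_comm.1 hU
  constructor
  · refine ⟨U.submatrix id (Fin.castLE hr), ?_, ?_⟩
    · have h : (U.submatrix id (Fin.castLE hr))ᵀ * U.submatrix id (Fin.castLE hr)
          = (Uᵀ * U).submatrix (Fin.castLE hr) (Fin.castLE hr) := rfl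
      rw [h, hU, submatrix_one _ hinj]
    · have h : (U.submatrix id (Fin.castLE hr))ᵀ * (U * diagonal μ * Uᵀ)
            * U.submatrix id (Fin.castLE hr)
          = (Uᵀ * (U * diagonal μ * Uᵀ) * U).submatrix (Fin.castLE hr) (Fin.castLE hr) := rfl
      have h' : Uᵀ * (U * diagonal μ * Uᵀ) * U = diagonal μ := by
        rw [Matrix.mul_assoc, Matrix.mul_assoc, hU, Matrix.mul_one, ← Matrix.mul_assoc, hU,
          Matrix.one_mul]
      rw [h, h', submatrix_diagonal _ _ hinj, trace_diagonal]
      rfl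
  · rintro x ⟨P, hP, rfl⟩
    have hQ : (Uᵀ * P)ᵀ * (Uᵀ * P) = 1 := by
      rw [transpose_mul, transpose_transpose, Matrix.mul_assoc, ← Matrix.mul_assoc U, hU',
        Matrix.one_mul, hP]
    refine (sum_castLE_le_trace_of_diagonal hr μ hμ _ hQ).trans_eq ?_
    simp only [transpose_mul, transpose_transpose, Matrix.mul_assoc]

theorem stmt8 (n f b r : ℕ) (hr : r ≤ b)
    (A : Fin n → Matrix (Fin f) (Fin b) ℝ)
    (Z : Matrix (Fin n) (Fin n) ℝ) (lam : ℝ)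
    (J : Matrix (Fin b) (Fin r) ℝ → ℝ)
    (hJ : ∀ P, J P = ∑ i, (frobSq (A i * P - ∑ j, Z j i • (A j * P))
        + lam * frobSq (A i - A i * P * Pᵀ)))
    (K : Fin n → Fin n → Matrix (Fin b) (Fin b) ℝ)
    (hK : ∀ i j, K i j = (A i)ᵀ * A j)
    (H1 H2 H3 M : Matrix (Fin b) (Fin b) ℝ)
    (hH1 : H1 = ∑ i, K i i)
    (hH2 : H2 = ∑ s, ∑ t, (∑ i, Z s i * Z t i) • K s t)
    (hH3 : H3 = ∑ i, ∑ j, Z j i • (K i j + K j i))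
    (hM : M = (1 - lam) • H1 + H2 - H3)
    -- μ lists the eigenvalues of the symmetric matrix M in nondecreasing
    -- order with multiplicity:
    (μ : Fin b → ℝ) (hμ : Monotone μ)
    (U : Matrix (Fin b) (Fin b) ℝ) (hU : Uᵀ * U = 1)
    (hspec : M = U * Matrix.diagonal μ * Uᵀ) :
    IsLeast {x : ℝ | ∃ P : Matrix (Fin b) (Fin r) ℝ, Pᵀ * P = 1 ∧ x = J P}
      ((∑ k : Fin r, μ (Fin.castLE hr k)) + lam * ∑ i, (K i i).trace) := by
  have hJM : ∀ P : Matrix (Fin b) (Fin r) ℝ, Pᵀ * P = 1 →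
      J P = (Pᵀ * M * P).trace + lam * ∑ i, (K i i).trace := by
    intro P hP
    have hM' : M = ∑ i, (K i i + ∑ s, ∑ t, (Z s i * Z t i) • K s t
        - ∑ j, Z j i • (K i j + K j i)) - lam • ∑ i, K i i := by
      have h2 : H2 = ∑ i, ∑ s, ∑ t, (Z s i * Z t i) • K s t := by
        simp only [hH2, Finset.sum_smul]
        rw [Finset.sum_comm]
        conv_rhs => rw [Finset.sum_comm]
        rw [Finset.sum_comm]
        exact Finset.sum_congr rfl fun s _ => Finset.sum_comm
      rw [hM, h2, hH1, hH3, Finset.sum_sub_distrib, Finset.sum_add_distrib, sub_smul, one_smul]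
      abel
    simp only [hJ, frobSq_sub_mul_mul_transpose _ P hP,
      frobSq_sub_sum_smul A (fun j => Z j _), ← hK]
    rw [hM', Matrix.mul_sub, Matrix.sub_mul, trace_sub, Matrix.mul_sum, Matrix.sum_mul, trace_sum,
      Matrix.mul_smul, Matrix.smul_mul, trace_smul, Matrix.mul_sum, Matrix.sum_mul, trace_sum,
      Finset.sum_add_distrib, ← Finset.mul_sum, Finset.sum_sub_distrib, smul_eq_mul]
    ring
  obtain ⟨⟨P, hP, hPμ⟩, hle⟩ := isLeast_trace_compression hr μ hμ U hU
  rw [← hspec] at hPμ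
  refine ⟨⟨P, hP, by rw [hJM P hP, hPμ]⟩, ?_⟩
  rintro x ⟨Q, hQ, rfl⟩
  rw [hJM Q hQ]
  have := hle ⟨Q, hQ, rfl⟩
  rw [← hspec] at this
  linarith
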